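/- Let A be a finite alphabet with d ≥ 3 letters, let B be a binary alphabet, and let X ⊆ A* be a finite complete synchronizing code all of whose words have length at most n (n ≥ 1). Let c be a positive integer such that every finite complete synchronizing code Y ⊆ B* whose words all have length at most ⌈log₂(d+1)⌉·n has a synchronizing pair (u,v) with |u·v| ≤ c. Then X has a synchronizing pair (u,v) with |u·v| ≤ ⌈c / ⌊log₂(d−1)⌋⌉. -/

import Mathlib

/-- The Kleene star of a set of words: the submonoid of the free monoid generated by `X`. -/
def Kstar {A : Type*} (X : Set (List A)) : Set (List A) :=
  {w | ∃ l : List (List A), (∀ x ∈ l, x ∈ X) ∧ l.flatten = w}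

/-- `X` is complete: every word has an `X`-completion. -/
def IsCompleteSet {A : Type*} (X : Set (List A)) : Prop :=
  ∀ w : List A, ∃ r s : List A, r ++ w ++ s ∈ Kstar X

/-- `(u, v)` is a synchronizing pair of `X`. -/
def IsSyncPair {A : Type*} (X : Set (List A)) (u v : List A) : Prop :=
  u ∈ Kstar X ∧ v ∈ Kstar X ∧
    ∀ r s : List A, r ++ (u ++ v) ++ s ∈ Kstar X →
      r ++ u ∈ Kstar X ∧ v ++ s ∈ Kstar X

/-- `X` is synchronizing: it has a synchronizing pair. -/
def IsSynchronizing {A : Type*} (X : Set (List A)) : Prop :=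
  ∃ u v : List A, IsSyncPair X u v

/-- `c` is a constant of `X`. -/
def IsConstant {A : Type*} (X : Set (List A)) (c : List A) : Prop :=
  c ∈ Kstar X ∧ ∀ u₁ u₂ u₃ u₄ : List A,
    u₁ ++ c ++ u₂ ∈ Kstar X → u₃ ++ c ++ u₄ ∈ Kstar X →
      u₁ ++ c ++ u₄ ∈ Kstar X ∧ u₃ ++ c ++ u₂ ∈ Kstar X

/-- `X` is a code: every word of `X*` has a unique factorization into words of `X`. -/
def IsCode {A : Type*} (X : Set (List A)) : Prop :=
  ∀ l₁ l₂ : List (List A), (∀ x ∈ l₁, x ∈ X) → (∀ x ∈ l₂, x ∈ X) →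
    l₁.flatten = l₂.flatten → l₁ = l₂

/-- `X` is a prefix code: no word of `X` is a proper prefix of another, and `X ≠ {ε}`. -/
def IsPrefixCode {A : Type*} (X : Set (List A)) : Prop :=
  (∀ x ∈ X, ∀ y ∈ X, x <+: y → x = y) ∧ X ≠ {([] : List A)}

/-- The monoid morphism `A* → B*` generated by the map `f` on letters. -/
def mlift {A B : Type*} (f : A → List B) : List A → List B :=
  fun w => (w.map f).flatten

section Kstar

variable {A : Type*} {X : Set (List A)}

theorem nil_mem_Kstar : [] ∈ Kstar X := ⟨[], by simp⟩

theorem mem_Kstar_of_mem {w : List A} (hw : w ∈ X) : w ∈ Kstar X := ⟨[w], by simpa using hw⟩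

theorem append_mem_Kstar {u v : List A} (hu : u ∈ Kstar X) (hv : v ∈ Kstar X) :
    u ++ v ∈ Kstar X := by
  obtain ⟨l, hl, rfl⟩ := hu
  obtain ⟨m, hm, rfl⟩ := hv
  refine ⟨l ++ m, fun x hx => ?_, by simp⟩
  rcases List.mem_append.1 hx with h | h
  exacts [hl x h, hm x h]

end Kstar

section mlift

variable {A B : Type*} {f : A → List B}

theorem mlift_append (u v : List A) : mlift f (u ++ v) = mlift f u ++ mlift f v := by
  simp [mlift]

theorem mlift_flatten (l : List (List A)) :
    mlift f l.flatten = (l.map (mlift f)).flatten := by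
  induction l with
  | nil => rfl
  | cons a l ih => simp [mlift_append, ih]

theorem length_mlift_le {D : ℕ} (hf : ∀ a, (f a).length ≤ D) (w : List A) :
    (mlift f w).length ≤ D * w.length := by
  induction w with
  | nil => simp [mlift]
  | cons a w ih =>
    have := hf a
    simp only [mlift, List.map_cons, List.flatten_cons, List.length_append,
      List.length_cons] at ih ⊢
    linarith

theorem le_length_mlift {D : ℕ} (hf : ∀ a, D ≤ (f a).length) (w : List A) :
    D * w.length ≤ (mlift f w).length := by
  induction w with
  | nil => simp
  | cons a w ih =>
    have := hf a
    simp only [mlift, List.map_cons, List.flatten_cons, List.length_append,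
      List.length_cons] at ih ⊢
    linarith

theorem exists_map_mlift_eq {X : Set (List A)} (l : List (List B))
    (hl : ∀ y ∈ l, y ∈ mlift f '' X) :
    ∃ m : List (List A), (∀ x ∈ m, x ∈ X) ∧ m.map (mlift f) = l := by
  induction l with
  | nil => exact ⟨[], by simp⟩
  | cons y l ih =>
    obtain ⟨m, hm, rfl⟩ := ih fun z hz => hl z (by simp [hz])
    obtain ⟨x, hx, rfl⟩ := hl y (by simp)
    exact ⟨x :: m, by simpa using ⟨hx, hm⟩, by simp⟩

theorem Kstar_image_mlift (X : Set (List A)) : Kstar (mlift f '' X) = mlift f '' Kstar X := by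
  ext w
  constructor
  · rintro ⟨l, hl, rfl⟩
    obtain ⟨m, hm, rfl⟩ := exists_map_mlift_eq l hl
    exact ⟨m.flatten, ⟨m, hm, rfl⟩, mlift_flatten m⟩
  · rintro ⟨_, ⟨m, hm, rfl⟩, rfl⟩
    refine ⟨m.map (mlift f), fun y hy => ?_, (mlift_flatten m).symm⟩
    obtain ⟨x, hx, rfl⟩ := List.mem_map.1 hy
    exact ⟨x, hm x hx, rfl⟩

theorem mem_Kstar_range_iff {w : List B} : w ∈ Kstar (Set.range f) ↔ w ∈ Set.range (mlift f) := by
  constructor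
  · rintro ⟨l, hl, rfl⟩
    induction l with
    | nil => exact ⟨[], rfl⟩
    | cons y l ih =>
      obtain ⟨v, hv⟩ := ih fun z hz => hl z (by simp [hz])
      obtain ⟨a, rfl⟩ := hl y (by simp)
      exact ⟨a :: v, by simp [mlift, ← hv]⟩
  · rintro ⟨v, rfl⟩
    refine ⟨v.map f, fun y hy => ?_, rfl⟩
    obtain ⟨a, -, rfl⟩ := List.mem_map.1 hy
    exact ⟨a, rfl⟩

theorem IsCode.image_mlift {X : Set (List A)} (hX : IsCode X)
    (hf : Function.Injective (mlift f)) : IsCode (mlift f '' X) := by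
  intro l₁ l₂ h₁ h₂ h
  obtain ⟨m₁, hm₁, rfl⟩ := exists_map_mlift_eq l₁ h₁
  obtain ⟨m₂, hm₂, rfl⟩ := exists_map_mlift_eq l₂ h₂
  rw [← mlift_flatten, ← mlift_flatten] at h
  rw [hX m₁ m₂ hm₁ hm₂ (hf h)]

theorem IsCompleteSet.image_mlift {X : Set (List A)} (hX : IsCompleteSet X)
    (hf : ∀ w : List B, ∃ s, w ++ s ∈ Set.range (mlift f)) : IsCompleteSet (mlift f '' X) := by
  intro w
  obtain ⟨s, v, hv⟩ := hf w
  obtain ⟨p, q, hpq⟩ := hX v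
  refine ⟨mlift f p, s ++ mlift f q, ?_⟩
  rw [Kstar_image_mlift]
  exact ⟨_, hpq, by simp [mlift_append, hv]⟩

/-- The image of a complete synchronizing set under an encoding by a right unitary submonoid
with a word `mlift f t` that resets every reading position is synchronizing. -/
theorem IsSynchronizing.image_mlift {X : Set (List A)} (hX : IsSynchronizing X)
    (hXc : IsCompleteSet X) (hf : Function.Injective (mlift f))
    (hpre : ∀ u v, u ∈ Set.range (mlift f) → u ++ v ∈ Set.range (mlift f) →
      v ∈ Set.range (mlift f))
    (t : List A) (ht : ∀ r, r ++ mlift f t ∈ Set.range (mlift f)) :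
    IsSynchronizing (mlift f '' X) := by
  obtain ⟨u, v, hu, hv, huv⟩ := hX
  obtain ⟨p, q, hpq⟩ := hXc t
  refine ⟨mlift f (p ++ t ++ q ++ u), mlift f v, ?_, ?_, fun r s h => ?_⟩
  · rw [Kstar_image_mlift]
    exact ⟨_, append_mem_Kstar hpq hu, rfl⟩
  · rw [Kstar_image_mlift]
    exact ⟨_, hv, rfl⟩
  rw [Kstar_image_mlift] at h ⊢
  obtain ⟨x, hx, hxe⟩ := h
  obtain ⟨r', hr'⟩ := ht (r ++ mlift f p)
  have hmid : mlift f x = mlift f (r' ++ q ++ u ++ v) ++ s := by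
    simp only [mlift_append, hr', hxe, List.append_assoc]
  obtain ⟨s', rfl⟩ := hpre _ s ⟨_, rfl⟩ ⟨x, hmid⟩
  rw [← mlift_append] at hmid
  have hx' := hf hmid
  obtain ⟨h₁, h₂⟩ := huv (r' ++ q) s' (by simpa [hx'] using hx)
  exact ⟨⟨_, h₁, by simp only [mlift_append, hr', List.append_assoc]⟩,
    ⟨_, h₂, mlift_append _ _⟩⟩

theorem IsSyncPair.of_image_mlift {X : Set (List A)} {u v : List A}
    (hf : Function.Injective (mlift f))
    (h : IsSyncPair (mlift f '' X) (mlift f u) (mlift f v)) : IsSyncPair X u v := by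
  simp only [IsSyncPair, Kstar_image_mlift] at h
  obtain ⟨hu, hv, huv⟩ := h
  refine ⟨hf.mem_set_image.1 hu, hf.mem_set_image.1 hv, fun r s hrs => ?_⟩
  have := huv (mlift f r) (mlift f s) (by
    simpa only [← mlift_append, hf.mem_set_image] using hrs)
  simpa only [← mlift_append, hf.mem_set_image] using this

end mlift

section Tree

variable {B : Type*}

/-- `I` is the set of interior nodes of a complete tree with at least one interior node. -/
structure IsInterior (I : Finset (List B)) : Prop where
  nil_mem : [] ∈ I
  mem_of_concat_mem : ∀ w b, w ++ [b] ∈ I → w ∈ I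

/-- The leaves of the complete tree with set of interior nodes `I`. -/
def leaves (I : Finset (List B)) : Set (List B) :=
  {w | (∃ p ∈ I, ∃ b, w = p ++ [b]) ∧ w ∉ I}

variable {I : Finset (List B)}

theorem concat_mem_leaves {p : List B} {b : B} (hp : p ∈ I) (h : p ++ [b] ∉ I) :
    p ++ [b] ∈ leaves I := ⟨⟨p, hp, b, rfl⟩, h⟩

theorem ncard_leaves [Fintype B] (hI : IsInterior I) :
    (leaves I).ncard + I.card = I.card * Fintype.card B + 1 := by
  classical
  set P : Finset (List B) := (I ×ˢ Finset.univ).image fun p : List B × B => p.1 ++ [p.2] with hP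
  have hPcard : P.card = I.card * Fintype.card B := by
    rw [hP, Finset.card_image_of_injective, Finset.card_product, Finset.card_univ]
    rintro ⟨p, b⟩ ⟨q, c⟩ h
    simpa [List.append_inj_left', List.append_inj_right'] using h
  have hmem : ∀ w, w ∈ P ↔ ∃ p ∈ I, ∃ b, w = p ++ [b] := by
    intro w
    simp only [hP, Finset.mem_image, Finset.mem_product, Finset.mem_univ, and_true, Prod.exists]
    grind
  have hleaves : leaves I = ↑(P \ I) := by
    ext w
    simp [leaves, hmem]
  have hinter : I ∩ P = I.erase [] := by
    ext w
    simp only [Finset.mem_inter, Finset.mem_erase, hmem]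
    constructor
    · rintro ⟨hw, p, -, b, rfl⟩
      simp [hw]
    · rintro ⟨hne, hw⟩
      obtain ⟨p, b, rfl⟩ := (List.eq_nil_or_concat' w).resolve_left hne
      exact ⟨hw, p, hI.mem_of_concat_mem p b hw, b, rfl⟩
  have h₁ := Finset.card_sdiff_add_card_inter P I
  rw [Finset.inter_comm, hinter, Finset.card_erase_of_mem hI.nil_mem] at h₁
  have h₂ := Finset.card_pos.2 ⟨_, hI.nil_mem⟩
  rw [hleaves, Set.ncard_coe_finset]
  omega

namespace IsInterior

theorem mem_of_append_mem (hI : IsInterior I) {p s : List B} (h : p ++ s ∈ I) : p ∈ I := by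
  induction s using List.reverseRecOn with
  | nil => simpa using h
  | append_singleton s b ih =>
    exact ih (hI.mem_of_concat_mem _ b (by simpa using h))

theorem eq_nil_of_append_mem_leaves (hI : IsInterior I) {p s : List B} (hp : p ∉ I)
    (h : p ++ s ∈ leaves I) : s = [] := by
  by_contra hs
  obtain ⟨t, c, rfl⟩ := (List.eq_nil_or_concat' s).resolve_left hs
  obtain ⟨⟨q, hq, b, hqb⟩, -⟩ := h
  rw [← List.append_assoc] at hqb
  rw [← List.append_inj_left' hqb rfl] at hq
  exact hp (hI.mem_of_append_mem hq)

theorem leaf_eq_of_append_eq (hI : IsInterior I) {z z' s s' : List B} (hz : z ∈ leaves I)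
    (hz' : z' ∈ leaves I) (h : z ++ s = z' ++ s') : z = z' := by
  rcases List.append_eq_append_iff.1 h with ⟨t, rfl, -⟩ | ⟨t, rfl, -⟩
  · simp [hI.eq_nil_of_append_mem_leaves hz.2 hz']
  · simp [hI.eq_nil_of_append_mem_leaves hz'.2 hz]

theorem ne_nil_of_mem_leaves {z : List B} (hz : z ∈ leaves I) : z ≠ [] := by
  obtain ⟨⟨p, -, b, rfl⟩, -⟩ := hz
  simp

theorem mem_Kstar_of_append_mem (hI : IsInterior I) {u v : List B} (hu : u ∈ Kstar (leaves I))
    (huv : u ++ v ∈ Kstar (leaves I)) : v ∈ Kstar (leaves I) := by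
  obtain ⟨l, hl, rfl⟩ := hu
  induction l with
  | nil => simpa using huv
  | cons z l ih =>
    refine ih (fun x hx => hl x (by simp [hx])) ?_
    obtain ⟨m, hm, hmeq⟩ := huv
    have hz := hl z (by simp)
    cases m with
    | nil => simp [ne_nil_of_mem_leaves hz] at hmeq
    | cons z' m =>
      simp only [List.flatten_cons, List.append_assoc] at hmeq
      obtain rfl := hI.leaf_eq_of_append_eq (hm z' (by simp)) hz hmeq
      exact ⟨m, fun x hx => hm x (by simp [hx]), by simpa using hmeq⟩

theorem mlift_injective {A : Type*} (hI : IsInterior I) {f : A → List B}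
    (hf : Function.Injective f) (hfI : ∀ a, f a ∈ leaves I) :
    Function.Injective (mlift f) := by
  intro u
  induction u with
  | nil =>
    intro v h
    cases v with
    | nil => rfl
    | cons b v => simp [mlift, ne_nil_of_mem_leaves (hfI b)] at h
  | cons a u ih =>
    intro v h
    cases v with
    | nil => simp [mlift, ne_nil_of_mem_leaves (hfI a)] at h
    | cons b v =>
      simp only [mlift, List.map_cons, List.flatten_cons] at h
      have hab := hf (hI.leaf_eq_of_append_eq (hfI a) (hfI b) h)
      subst hab
      rw [ih (List.append_cancel_left h)]

theorem exists_eq_append (hI : IsInterior I) (w : List B) :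
    ∃ u ∈ Kstar (leaves I), ∃ p ∈ I, w = u ++ p := by
  induction w using List.reverseRecOn with
  | nil => exact ⟨[], nil_mem_Kstar, [], hI.nil_mem, rfl⟩
  | append_singleton w b ih =>
    obtain ⟨u, hu, p, hp, rfl⟩ := ih
    by_cases h : p ++ [b] ∈ I
    · exact ⟨u, hu, p ++ [b], h, by simp⟩
    · exact ⟨u ++ (p ++ [b]), append_mem_Kstar hu (mem_Kstar_of_mem (concat_mem_leaves hp h)),
        [], hI.nil_mem, by simp⟩

theorem exists_append_replicate_mem (hI : IsInterior I) (o : B) (w : List B) :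
    ∃ t, w ++ List.replicate t o ∈ Kstar (leaves I) := by
  classical
  obtain ⟨u, hu, p, hp, rfl⟩ := hI.exists_eq_append w
  have hex : ∃ t, p ++ List.replicate t o ∉ I := by
    refine ⟨I.sup List.length + 1, fun h => ?_⟩
    have := Finset.le_sup (f := List.length) h
    rw [List.length_append, List.length_replicate] at this
    omega
  have hspec := Nat.find_spec hex
  obtain ⟨t, ht⟩ : ∃ t, Nat.find hex = t + 1 := by
    refine Nat.exists_eq_succ_of_ne_zero fun h0 => ?_
    rw [h0] at hspec
    exact hspec (by simpa using hp)
  have hmin : p ++ List.replicate t o ∈ I := not_not.1 (Nat.find_min hex (by omega : t < _))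
  rw [ht, List.replicate_succ', ← List.append_assoc] at hspec
  refine ⟨t + 1, ?_⟩
  rw [List.replicate_succ', List.append_assoc, ← List.append_assoc p]
  exact append_mem_Kstar hu (mem_Kstar_of_mem (concat_mem_leaves hmin hspec))

theorem exists_reset_of_merge (hI : IsInterior I)
    (h : ∀ r, ∃ w ∈ Kstar (leaves I), r ++ w ∈ Kstar (leaves I)) :
    ∃ z ∈ Kstar (leaves I), ∀ r, r ++ z ∈ Kstar (leaves I) := by
  classical
  have key : ∀ J : Finset (List B), ∃ z ∈ Kstar (leaves I), ∀ p ∈ J,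
      p ++ z ∈ Kstar (leaves I) := by
    intro J
    induction J using Finset.induction_on with
    | empty => exact ⟨[], nil_mem_Kstar, by simp⟩
    | insert p J _ ih =>
      obtain ⟨z, hz, hzJ⟩ := ih
      obtain ⟨w, hw, hpw⟩ := h (p ++ z)
      refine ⟨z ++ w, append_mem_Kstar hz hw, fun q hq => ?_⟩
      rw [← List.append_assoc]
      rcases Finset.mem_insert.1 hq with rfl | hq
      exacts [hpw, append_mem_Kstar (hzJ q hq) hw]
  obtain ⟨z, hz, hzI⟩ := key I
  refine ⟨z, hz, fun r => ?_⟩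
  obtain ⟨u, hu, p, hp, rfl⟩ := hI.exists_eq_append r
  rw [List.append_assoc]
  exact append_mem_Kstar hu (hzI p hp)

end IsInterior

/-- Reading positions at distance `δ` on the branch labelled by `o` can be merged. -/
def Mergeable (Z : Set (List B)) (o : B) (δ : ℕ) : Prop :=
  ∃ w ∈ Kstar Z, List.replicate δ o ++ w ∈ Kstar Z

theorem Mergeable.of_branches {Z : Set (List B)} {o l : B} {δ i a b : ℕ}
    (ha : List.replicate i o ++ l :: List.replicate a o ∈ Z)
    (hb : List.replicate (i + δ) o ++ l :: List.replicate b o ∈ Z)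
    (h : Mergeable Z o (a - b + (b - a))) : Mergeable Z o δ := by
  obtain ⟨w, hw, hw'⟩ := h
  have ha' := mem_Kstar_of_mem ha
  have hb' := mem_Kstar_of_mem hb
  rw [add_comm i δ, List.replicate_add] at hb'
  simp only [List.append_assoc] at ha' hb'
  rcases le_total a b with hab | hab
  · have hba : List.replicate b o =
        List.replicate a o ++ List.replicate (a - b + (b - a)) o := by
      rw [← List.replicate_add]
      congr 1
      omega
    refine ⟨List.replicate i o ++ l :: List.replicate b o ++ w, ?_, ?_⟩
    · rw [hba]
      simpa only [List.append_assoc, List.cons_append] using append_mem_Kstar ha' hw'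
    · simpa only [List.append_assoc, List.cons_append] using append_mem_Kstar hb' hw
  · have hab : List.replicate a o =
        List.replicate b o ++ List.replicate (a - b + (b - a)) o := by
      rw [← List.replicate_add]
      congr 1
      omega
    refine ⟨List.replicate i o ++ l :: List.replicate a o ++ w, append_mem_Kstar ha' hw, ?_⟩
    rw [hab]
    simpa only [List.append_assoc, List.cons_append] using append_mem_Kstar hb' hw'

theorem mergeable_of_branches {Z : Set (List B)} {o l : B} {K : ℕ}
    (hK : List.replicate K o ∈ Z) (hKpos : 0 < K)
    (h : ∀ δ, 0 < δ → δ < K → ∃ i a b, List.replicate i o ++ l :: List.replicate a o ∈ Z ∧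
      List.replicate (i + δ) o ++ l :: List.replicate b o ∈ Z ∧ a - b + (b - a) < δ) (δ : ℕ) :
    Mergeable Z o δ := by
  induction δ using Nat.strong_induction_on with
  | _ δ ih =>
    rcases Nat.eq_zero_or_pos δ with rfl | hδ
    · exact ⟨[], nil_mem_Kstar, by simpa using nil_mem_Kstar⟩
    rcases lt_or_ge δ K with hlt | hge
    · obtain ⟨i, a, b, ha, hb, hab⟩ := h δ hδ hlt
      exact .of_branches ha hb (ih _ hab)
    · obtain ⟨w, hw, hw'⟩ := ih (δ - K) (by omega)
      refine ⟨w, hw, ?_⟩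
      have h₁ := append_mem_Kstar (mem_Kstar_of_mem hK) hw'
      rwa [← List.append_assoc, ← List.replicate_add, Nat.add_sub_cancel' hge] at h₁

theorem IsInterior.exists_reset (hI : IsInterior I) {o : B}
    (h : ∀ δ, Mergeable (leaves I) o δ) :
    ∃ z ∈ Kstar (leaves I), ∀ r, r ++ z ∈ Kstar (leaves I) := by
  refine hI.exists_reset_of_merge fun r => ?_
  obtain ⟨t, ht⟩ := hI.exists_append_replicate_mem o r
  obtain ⟨w, hw, hw'⟩ := h t
  exact ⟨_, hw', by simpa using append_mem_Kstar ht hw⟩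

theorem isInterior_of_length {I : Finset (List B)} {L : ℕ} (hL : 0 < L)
    (hlow : ∀ w : List B, w.length < L → w ∈ I)
    (hup : ∀ w b, w ++ [b] ∈ I → w.length ≤ L ∧ (w.length = L → w ∈ I)) : IsInterior I where
  nil_mem := hlow _ (by simpa using hL)
  mem_of_concat_mem w b h := by
    obtain ⟨h₁, h₂⟩ := hup w b h
    rcases h₁.lt_or_eq with h | h
    exacts [hlow w h, h₂ h]

end Tree

section SingleMark

variable {B : Type*}

/-- The word with `n` letters all equal to `o`, except a letter `l` at position `i`. -/
def singleMark (o l : B) (n i : ℕ) : List B :=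
  List.replicate i o ++ l :: List.replicate (n - 1 - i) o

theorem length_singleMark (o l : B) {n i : ℕ} (h : i < n) :
    (singleMark o l n i).length = n := by
  simp [singleMark]
  omega

theorem singleMark_ne_replicate {o l : B} (hol : o ≠ l) (n i m : ℕ) :
    singleMark o l n i ≠ List.replicate m o := by
  intro h
  have : l ∈ List.replicate m o := by
    rw [← h]
    simp [singleMark]
  exact hol (List.eq_of_mem_replicate this).symm

theorem singleMark_succ (o l : B) {n i : ℕ} (h : i < n) :
    singleMark o l (n + 1) i = singleMark o l n i ++ [o] := by
  have : n + 1 - 1 - i = (n - 1 - i) + 1 := by omega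
  simp only [singleMark, this, List.replicate_succ', List.append_assoc, List.cons_append]

theorem singleMark_eq_concat (o l : B) (n : ℕ) :
    singleMark o l (n + 1) n = List.replicate n o ++ [l] := by
  simp [singleMark]

theorem singleMark_inj {o l : B} (hol : o ≠ l) {n i j : ℕ}
    (h : singleMark o l n i = singleMark o l n j) : i = j := by
  classical
  have hi : ∀ k m, List.idxOf l (List.replicate k o ++ l :: List.replicate m o) = k := by
    intro k m
    rw [List.idxOf_append_of_notMem]
    · simp
    · intro h'
      exact hol (List.eq_of_mem_replicate h').symm
  have := congrArg (List.idxOf l) h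
  simpa only [singleMark, hi] using this

theorem singleMark_mem_leaves {I : Finset (List B)} {o l : B} {n i : ℕ} (hi : i < n)
    (hlow : ∀ w : List B, w.length < n → w ∈ I) (h : singleMark o l n i ∉ I) :
    singleMark o l n i ∈ leaves I := by
  have hlen := length_singleMark o l hi
  obtain ⟨p, b, hpb⟩ := (List.eq_nil_or_concat' (singleMark o l n i)).resolve_left
    (by simp [singleMark])
  rw [hpb] at hlen h ⊢
  rw [List.length_append, List.length_singleton] at hlen
  exact concat_mem_leaves (hlow _ (by omega)) h

end SingleMark

section Construction

variable {B : Type*} [Fintype B] [DecidableEq B]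

/-- The words of length `n`. -/
def wordsOfLength (B : Type*) [Fintype B] [DecidableEq B] (n : ℕ) : Finset (List B) :=
  (Finset.univ : Finset (Fin n → B)).image List.ofFn

/-- The words of length less than `n`. -/
def wordsOfLengthLT (B : Type*) [Fintype B] [DecidableEq B] (n : ℕ) : Finset (List B) :=
  (Finset.range n).biUnion (wordsOfLength B)

@[simp]
theorem mem_wordsOfLength {n : ℕ} {w : List B} : w ∈ wordsOfLength B n ↔ w.length = n := by
  simp only [wordsOfLength, Finset.mem_image, Finset.mem_univ, true_and]
  constructor
  · rintro ⟨g, rfl⟩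
    simp
  · rintro rfl
    exact ⟨w.get, List.ofFn_get w⟩

@[simp]
theorem mem_wordsOfLengthLT {n : ℕ} {w : List B} : w ∈ wordsOfLengthLT B n ↔ w.length < n := by
  simp [wordsOfLengthLT]

theorem card_wordsOfLength (n : ℕ) : (wordsOfLength B n).card = Fintype.card B ^ n := by
  rw [wordsOfLength, Finset.card_image_of_injective _ List.ofFn_injective]
  simp

theorem card_wordsOfLengthLT (hB : Fintype.card B = 2) (n : ℕ) :
    (wordsOfLengthLT B n).card = 2 ^ n - 1 := by
  rw [wordsOfLengthLT, Finset.card_biUnion]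
  · simp only [card_wordsOfLength, hB]
    simpa using Nat.geomSum_eq le_rfl n
  · intro i _ j _ hij
    rw [Function.onFun, Finset.disjoint_left]
    intro w hi hj
    simp only [mem_wordsOfLength] at hi hj
    omega

theorem card_wordsOfLengthLT_union (hB : Fintype.card B = 2) {L : ℕ} {S : Finset (List B)}
    (hS : ∀ w ∈ S, L ≤ w.length) :
    (wordsOfLengthLT B L ∪ S).card = 2 ^ L - 1 + S.card := by
  rw [Finset.card_union_of_disjoint, card_wordsOfLengthLT hB]
  rw [Finset.disjoint_left]
  intro w hw hwS
  have := hS w hwS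
  simp only [mem_wordsOfLengthLT] at hw
  omega

/-- For every `e` with `2 ^ L ≤ e < 2 ^ (L + 1)` there is an almost balanced binary tree with `e`
interior nodes in which all distances can be merged. -/
theorem exists_mergeable_interior (hB : Fintype.card B = 2) {o l : B} (hol : o ≠ l) {L e : ℕ}
    (hL : 0 < L) (he : 2 ^ L ≤ e) (he' : e < 2 ^ (L + 1)) :
    ∃ I : Finset (List B), IsInterior I ∧ I.card = e ∧ (∀ w : List B, w.length < L → w ∈ I) ∧
      (∀ w ∈ I, w.length < Nat.clog 2 (e + 2)) ∧ ∀ δ, Mergeable (leaves I) o δ := by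
  have hclog : L < Nat.clog 2 (e + 2) := (Nat.lt_clog_iff_pow_lt one_lt_two).2 (by omega)
  have hLpow : 2 * L ≤ 2 ^ L := by
    obtain ⟨k, rfl⟩ := Nat.exists_eq_succ_of_ne_zero hL.ne'
    have := Nat.lt_two_pow_self (n := k)
    rw [pow_succ]
    omega
  have hcard := card_wordsOfLength (B := B) L
  rw [hB] at hcard
  rw [pow_succ] at he'
  have hrep : List.replicate L o ∈ wordsOfLength B L := by simp
  set W : Finset (List B) := insert (List.replicate L o)
    ((Finset.Ico 1 L).image (singleMark o l L)) with hW
  have hWcard : W.card ≤ L := by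
    refine (Finset.card_insert_le _ _).trans ?_
    have := Finset.card_image_le (s := Finset.Ico 1 L) (f := singleMark o l L)
    simp only [Nat.card_Ico] at this
    omega
  have hWsub : W ⊆ (wordsOfLength B L).erase (singleMark o l L 0) := by
    intro w hw
    rw [hW, Finset.mem_insert, Finset.mem_image] at hw
    rcases hw with rfl | ⟨i, hi, rfl⟩
    · simp [(singleMark_ne_replicate hol L 0 L).symm]
    · rw [Finset.mem_Ico] at hi
      rw [Finset.mem_erase, mem_wordsOfLength, length_singleMark _ _ hi.2]
      refine ⟨fun h => ?_, rfl⟩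
      have := singleMark_inj hol h
      omega
  have hmark : singleMark o l L 0 ∈ wordsOfLength B L := by
    simp [length_singleMark o l hL]
  have herase := Finset.card_erase_of_mem hmark
  have hbranch : ∀ I : Finset (List B), (∀ w : List B, w.length < L → w ∈ I) → W ⊆ I →
      singleMark o l L 0 ∉ I → (∀ w ∈ I, w.length ≤ L ∨ w = List.replicate (L + 1) o) →
      ∀ δ, 0 < δ → δ ≤ L → ∃ i a b,
        List.replicate i o ++ l :: List.replicate a o ∈ leaves I ∧
        List.replicate (i + δ) o ++ l :: List.replicate b o ∈ leaves I ∧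
        a - b + (b - a) < δ := by
    intro I hlow hWI hnot hup δ hδ hδL
    have hlen : ∀ n i, L < n → i < n → singleMark o l n i ∉ I := by
      intro n i hn hi hmem
      rcases hup _ hmem with h | h
      · rw [length_singleMark o l hi] at h
        omega
      · exact singleMark_ne_replicate hol _ _ _ h
    refine ⟨0, L - 1 - 0, L + 1 - 1 - δ, ?_, ?_, by omega⟩
    · exact singleMark_mem_leaves hL hlow hnot
    · rw [zero_add]
      change singleMark o l (L + 1) δ ∈ _
      have hnotin := hlen (L + 1) δ (by omega) (by omega)
      rcases hδL.lt_or_eq with h | rfl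
      · rw [singleMark_succ o l h] at hnotin ⊢
        refine concat_mem_leaves (hWI ?_) hnotin
        exact Finset.mem_insert_of_mem (Finset.mem_image_of_mem _ (by simp; omega))
      · rw [singleMark_eq_concat] at hnotin ⊢
        exact concat_mem_leaves (hWI (Finset.mem_insert_self _ _)) hnotin
  have hlevel : ∀ S ⊆ wordsOfLength B L, S.card = e + 1 - 2 ^ L →
      (List.replicate L o ∈ S) →
      (∀ δ, 0 < δ → δ ≤ L → ∃ i a b,
        List.replicate i o ++ l :: List.replicate a o ∈ leaves (wordsOfLengthLT B L ∪ S) ∧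
        List.replicate (i + δ) o ++ l :: List.replicate b o ∈ leaves (wordsOfLengthLT B L ∪ S) ∧
        a - b + (b - a) < δ) →
      ∃ I : Finset (List B), IsInterior I ∧ I.card = e ∧
        (∀ w : List B, w.length < L → w ∈ I) ∧
        (∀ w ∈ I, w.length < Nat.clog 2 (e + 2)) ∧ ∀ δ, Mergeable (leaves I) o δ := by
    intro S hS hScard hoS hbr
    have hSlen : ∀ w ∈ S, w.length = L := fun w hw => mem_wordsOfLength.1 (hS hw)
    have hIlen : ∀ w ∈ wordsOfLengthLT B L ∪ S, w.length ≤ L := by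
      intro w hw
      rcases Finset.mem_union.1 hw with h | h
      · exact (mem_wordsOfLengthLT.1 h).le
      · exact (hSlen w h).le
    have hlow : ∀ w : List B, w.length < L → w ∈ wordsOfLengthLT B L ∪ S := fun w hw =>
      Finset.mem_union_left _ (mem_wordsOfLengthLT.2 hw)
    refine ⟨wordsOfLengthLT B L ∪ S, isInterior_of_length hL hlow ?_, ?_, hlow,
      fun w hw => (hIlen w hw).trans_lt hclog, ?_⟩
    · intro w b h
      have := hIlen _ h
      simp only [List.length_append, List.length_singleton] at this
      omega
    · rw [card_wordsOfLengthLT_union hB fun w hw => (hSlen w hw).ge, hScard]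
      omega
    · refine mergeable_of_branches (l := l) (K := L + 1) ?_ (by omega)
        fun δ h₁ h₂ => hbr δ h₁ (by omega)
      rw [List.replicate_succ']
      refine concat_mem_leaves (Finset.mem_union_right _ hoS) fun h => ?_
      have := hIlen _ h
      simp at this
  rcases (show e + 1 ≤ 2 * 2 ^ L by omega).lt_or_eq with hlt | heq
  · rcases le_or_gt L (e + 1 - 2 ^ L) with hm | hm
    · obtain ⟨S, hWS, hS, hScard⟩ := Finset.exists_subsuperset_card_eq hWsub
        (n := e + 1 - 2 ^ L) (by omega) (by omega)
      have hSw := hS.trans (Finset.erase_subset _ _)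
      refine hlevel S hSw hScard (hWS (Finset.mem_insert_self _ _)) (hbranch _ ?_ ?_ ?_ ?_)
      · exact fun w hw => Finset.mem_union_left _ (mem_wordsOfLengthLT.2 hw)
      · exact hWS.trans Finset.subset_union_right
      · rw [Finset.mem_union, mem_wordsOfLengthLT, length_singleMark o l hL]
        rintro (h | h)
        · omega
        · exact (Finset.mem_erase.1 (hS h)).1 rfl
      · intro w hw
        left
        rcases Finset.mem_union.1 hw with h | h
        · exact (mem_wordsOfLengthLT.1 h).le
        · exact (mem_wordsOfLength.1 (hSw h)).le
    · set V : Finset (List B) := (Finset.range L).image (singleMark o l L) with hV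
      have hVcard : V.card ≤ L := by
        simpa using Finset.card_image_le (s := Finset.range L) (f := singleMark o l L)
      have hsub : {List.replicate L o} ⊆ wordsOfLength B L \ V := by
        rw [Finset.singleton_subset_iff, Finset.mem_sdiff, hV, Finset.mem_image]
        refine ⟨hrep, ?_⟩
        rintro ⟨i, -, hi⟩
        exact singleMark_ne_replicate hol _ _ _ hi
      have hdiff := Finset.le_card_sdiff V (wordsOfLength B L)
      obtain ⟨S, hoS, hS, hScard⟩ := Finset.exists_subsuperset_card_eq hsub
        (n := e + 1 - 2 ^ L) (by simp; omega) (by omega)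
      have hSw := hS.trans Finset.sdiff_subset
      rw [Finset.singleton_subset_iff] at hoS
      refine hlevel S hSw hScard hoS fun δ hδ hδL => ?_
      refine ⟨L - δ, L - 1 - (L - δ), 0, ?_, ?_, by omega⟩
      · have hlt : L - δ < L := by omega
        refine singleMark_mem_leaves hlt
          (fun w hw => Finset.mem_union_left _ (mem_wordsOfLengthLT.2 hw)) ?_
        rw [Finset.mem_union, mem_wordsOfLengthLT, length_singleMark o l hlt]
        rintro (h | h)
        · omega
        · exact (Finset.mem_sdiff.1 (hS h)).2
            (Finset.mem_image_of_mem _ (Finset.mem_range.2 hlt))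
      · rw [Nat.sub_add_cancel hδL]
        refine concat_mem_leaves (Finset.mem_union_right _ hoS) fun h => ?_
        rcases Finset.mem_union.1 h with h | h
        · have := mem_wordsOfLengthLT.1 h
          simp at this
        · have := mem_wordsOfLength.1 (hSw h)
          simp at this
  · have hclog' : L + 1 < Nat.clog 2 (e + 2) :=
      (Nat.lt_clog_iff_pow_lt one_lt_two).2 (by rw [pow_succ]; omega)
    set S : Finset (List B) := insert (List.replicate (L + 1) o)
      ((wordsOfLength B L).erase (singleMark o l L 0)) with hS
    have hScard : S.card = 2 ^ L := by
      rw [hS, Finset.card_insert_of_notMem (by simp)]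
      have : 0 < 2 ^ L := by positivity
      omega
    have hmem : ∀ w ∈ wordsOfLengthLT B L ∪ S, w.length ≤ L ∨ w = List.replicate (L + 1) o := by
      intro w hw
      rw [hS, Finset.mem_union, Finset.mem_insert, Finset.mem_erase] at hw
      rcases hw with h | h | h
      · exact .inl (mem_wordsOfLengthLT.1 h).le
      · exact .inr h
      · exact .inl (mem_wordsOfLength.1 h.2).le
    have hlow : ∀ w : List B, w.length < L → w ∈ wordsOfLengthLT B L ∪ S := fun w hw =>
      Finset.mem_union_left _ (mem_wordsOfLengthLT.2 hw)
    have hWI : W ⊆ wordsOfLengthLT B L ∪ S :=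
      (hWsub.trans (Finset.subset_insert _ _)).trans Finset.subset_union_right
    have hrepI : List.replicate (L + 1) o ∈ wordsOfLengthLT B L ∪ S :=
      Finset.mem_union_right _ (Finset.mem_insert_self _ _)
    have hnot : singleMark o l L 0 ∉ wordsOfLengthLT B L ∪ S := by
      rw [Finset.mem_union, mem_wordsOfLengthLT, length_singleMark o l hL, hS,
        Finset.mem_insert, Finset.mem_erase]
      rintro (h | h | h)
      · omega
      · exact singleMark_ne_replicate hol _ _ _ h
      · exact h.1 rfl
    have hcI : ∀ b, List.replicate (L + 1) o ++ [b] ∉ wordsOfLengthLT B L ∪ S := by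
      intro b h
      rcases hmem _ h with h | h
      · simp only [List.length_append, List.length_replicate, List.length_singleton] at h
        omega
      · simpa using congrArg List.length h
    refine ⟨wordsOfLengthLT B L ∪ S, isInterior_of_length hL hlow ?_, ?_, hlow, ?_, ?_⟩
    · intro w b h
      rcases hmem _ h with h | h
      · simp only [List.length_append, List.length_singleton] at h
        omega
      · rw [List.replicate_succ'] at h
        rw [List.append_inj_left' h rfl]
        exact ⟨by simp, fun _ => hWI (Finset.mem_insert_self _ _)⟩
    · rw [card_wordsOfLengthLT_union hB, hScard]
      · have : 0 < 2 ^ L := by positivity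
        omega
      · intro w hw
        rcases Finset.mem_insert.1 hw with rfl | h
        · simp
        · exact (mem_wordsOfLength.1 (Finset.mem_of_mem_erase h)).ge
    · intro w hw
      rcases hmem w hw with h | rfl
      · omega
      · simpa using hclog'
    · refine mergeable_of_branches (l := l) (K := L + 2) ?_ (by omega) fun δ h₁ h₂ => ?_
      · rw [List.replicate_succ']
        exact concat_mem_leaves hrepI (hcI o)
      rcases (show δ ≤ L + 1 by omega).lt_or_eq with h | rfl
      · exact hbranch _ hlow hWI hnot hmem δ h₁ (by omega)
      · refine ⟨0, L - 1 - 0, 0, ?_, ?_, by omega⟩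
        · exact singleMark_mem_leaves hL hlow hnot
        · rw [zero_add]
          exact concat_mem_leaves hrepI (hcI l)

end Construction

/-- An alphabet with at least three letters embeds into a binary free monoid as a complete prefix
code with a resetting word. -/
theorem exists_synchronizing_encoding {A B : Type*} [Fintype A] [Fintype B]
    (hA : 3 ≤ Fintype.card A) (hB : Fintype.card B = 2) :
    ∃ f : A → List B, Function.Injective (mlift f) ∧
      (∀ a, Nat.log 2 (Fintype.card A - 1) ≤ (f a).length) ∧
      (∀ a, (f a).length ≤ Nat.clog 2 (Fintype.card A + 1)) ∧
      (∀ w : List B, ∃ s, w ++ s ∈ Set.range (mlift f)) ∧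
      (∀ u v, u ∈ Set.range (mlift f) → u ++ v ∈ Set.range (mlift f) →
        v ∈ Set.range (mlift f)) ∧
      ∃ t, ∀ r, r ++ mlift f t ∈ Set.range (mlift f) := by
  classical
  obtain ⟨o, l, hol⟩ := Fintype.exists_pair_of_one_lt_card (by omega : 1 < Fintype.card B)
  obtain ⟨I, hI, hcard, hlow, hup, hmerge⟩ := exists_mergeable_interior hB hol
    (L := Nat.log 2 (Fintype.card A - 1)) (e := Fintype.card A - 1)
    (Nat.log_pos one_lt_two (by omega)) (Nat.pow_log_le_self 2 (by omega))
    (Nat.lt_pow_succ_log_self one_lt_two _)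
  have hleaves := ncard_leaves hI
  rw [hB, hcard] at hleaves
  have hcardEq : Nat.card A = Nat.card (leaves I) := by
    rw [Nat.card_eq_fintype_card, Nat.card_coe_set_eq]
    omega
  have hfin : (leaves I).Finite := Set.finite_of_ncard_pos (by omega)
  have := hfin.to_subtype
  obtain ⟨φ⟩ : Nonempty (A ≃ leaves I) := Finite.card_eq.1 hcardEq
  let f : A → List B := fun a => φ a
  have hfI : ∀ a, f a ∈ leaves I := fun a => (φ a).2
  have hrange : Set.range f = leaves I := by
    ext w
    exact ⟨fun ⟨a, ha⟩ => ha ▸ hfI a, fun hw => ⟨φ.symm ⟨w, hw⟩, by simp [f]⟩⟩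
  have hK : ∀ w, w ∈ Set.range (mlift f) ↔ w ∈ Kstar (leaves I) := by
    intro w
    rw [← mem_Kstar_range_iff, hrange]
  have hinj : Function.Injective f := Subtype.val_injective.comp φ.injective
  refine ⟨f, hI.mlift_injective hinj hfI, fun a => ?_, fun a => ?_, fun w => ?_,
    fun u v hu huv => ?_, ?_⟩
  · by_contra! h
    exact (hfI a).2 (hlow _ h)
  · obtain ⟨⟨p, hp, b, hpb⟩, -⟩ := hfI a
    have := hup p hp
    rw [show Fintype.card A - 1 + 2 = Fintype.card A + 1 by omega] at this
    rw [hpb]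
    simpa using this
  · obtain ⟨t, ht⟩ := hI.exists_append_replicate_mem o w
    exact ⟨_, (hK _).2 ht⟩
  · rw [hK] at hu huv ⊢
    exact hI.mem_Kstar_of_append_mem hu huv
  · obtain ⟨z, hz, hreset⟩ := hI.exists_reset hmerge
    obtain ⟨t, rfl⟩ := (hK z).2 hz
    exact ⟨t, fun r => (hK _).2 (hreset r)⟩

/-- Reduction to the binary case for synchronizing pairs of finite complete synchronizing
codes. -/
theorem syncPair_reduction_to_binary_complete {A B : Type*} [Fintype A] [Fintype B]
    (d n c : ℕ) (hA : Fintype.card A = d) (hd : 3 ≤ d) (hB : Fintype.card B = 2)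
    (hn : 1 ≤ n) (hc : 0 < c)
    (X : Set (List A)) (hXfin : X.Finite) (hXlen : ∀ w ∈ X, w.length ≤ n)
    (hXcode : IsCode X) (hXcomp : IsCompleteSet X) (hXsync : IsSynchronizing X)
    (hC : ∀ Y : Set (List B), Y.Finite → (∀ w ∈ Y, w.length ≤ Nat.clog 2 (d + 1) * n) →
      IsCode Y → IsCompleteSet Y → IsSynchronizing Y →
      ∃ u v : List B, IsSyncPair Y u v ∧ (u ++ v).length ≤ c) :
    ∃ u v : List A, IsSyncPair X u v ∧
      ((u ++ v).length : ℤ) ≤ ⌈(c : ℚ) / (Nat.log 2 (d - 1) : ℚ)⌉ := by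
  subst hA
  obtain ⟨f, hinj, hlow, hup, hcomp, hpre, t, ht⟩ := exists_synchronizing_encoding hd hB
  obtain ⟨u, v, huv, hlen⟩ := hC (mlift f '' X) (hXfin.image _)
    (by
      rintro _ ⟨w, hw, rfl⟩
      exact (length_mlift_le hup w).trans (Nat.mul_le_mul_left _ (hXlen w hw)))
    (hXcode.image_mlift hinj) (hXcomp.image_mlift hcomp)
    (hXsync.image_mlift hXcomp hinj hpre t ht)
  have hu := huv.1
  have hv := huv.2.1
  rw [Kstar_image_mlift] at hu hv
  obtain ⟨u, -, rfl⟩ := hu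
  obtain ⟨v, -, rfl⟩ := hv
  refine ⟨u, v, huv.of_image_mlift hinj, ?_⟩
  rw [← mlift_append] at hlen
  have hle := (le_length_mlift hlow (u ++ v)).trans hlen
  have hlog : 0 < Nat.log 2 (Fintype.card A - 1) := Nat.log_pos one_lt_two (by omega)
  have hq : ((u ++ v).length : ℚ) ≤ (c : ℚ) / (Nat.log 2 (Fintype.card A - 1) : ℚ) := by
    rw [le_div_iff₀ (by exact_mod_cast hlog), mul_comm]
    exact_mod_cast hle
  exact_mod_cast hq.trans (Int.le_ceil _)
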